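/- (SDS minimizes the KL objective) For every θ ∈ ℝᴺ, the Score Distillation Sampling update equals the gradient of the KL objective: −E_{t~U[0,T], c~p_c, ε~N(0,I_D)}[ ω(t) (∂g(θ,c)/∂θ)ᵀ ( σ_t ∇log p_t(x_t) − ε ) ] = ∇_θ J_KL(θ), where x_t = α_t g(θ,c) + σ_t ε; equivalently, the extra noise term satisfies E_{t~U[0,T], c~p_c, ε~N(0,I_D)}[ ω(t) (∂g(θ,c)/∂θ)ᵀ ε ] = 0. -/

import Mathlib

open MeasureTheory Real

noncomputable section

/-- The isotropic Gaussian density `N(m, σ² I_D)` on `EuclideanSpace ℝ (Fin D)`. -/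
def gaussPDF {D : ℕ} (m : EuclideanSpace ℝ (Fin D)) (σ : ℝ)
    (x : EuclideanSpace ℝ (Fin D)) : ℝ :=
  (2 * π * σ ^ 2) ^ (-(D : ℝ) / 2) * exp (-‖x - m‖ ^ 2 / (2 * σ ^ 2))

/-- `KL(q ‖ p) = ∫ q log (q / p)` (w.r.t. Lebesgue measure). -/
def klDivFn {D : ℕ} (q p : EuclideanSpace ℝ (Fin D) → ℝ) : ℝ :=
  ∫ x, q x * log (q x / p x)

variable {N D : ℕ} {C : Type*} [MeasurableSpace C]

/-- The vanilla KL objective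
`J_KL(θ) = E_{t ~ U[0,T], c ~ p_c}[Ω(t) KL(q_t^θ(·|c) ‖ p_t)]` with `Ω(t) = ω(t)σ_t/α_t`,
where `q_t^θ(·|c) = N(α_t g(θ,c), σ_t² I_D)`. -/
def Jkl (pc : Measure C) (T : ℝ) (a s w : ℝ → ℝ)
    (g : EuclideanSpace ℝ (Fin N) → C → EuclideanSpace ℝ (Fin D))
    (p : ℝ → EuclideanSpace ℝ (Fin D) → ℝ)
    (θ : EuclideanSpace ℝ (Fin N)) : ℝ :=
  (1 / T) * ∫ t in Set.Icc (0 : ℝ) T,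
    (∫ c, w t * s t / a t * klDivFn (gaussPDF (a t • g θ c) (s t)) (p t) ∂pc)

lemma gaussPDF_zero_neg (σ : ℝ) (x : EuclideanSpace ℝ (Fin D)) :
    gaussPDF 0 σ (-x) = gaussPDF 0 σ x := by
  simp [gaussPDF]

lemma gaussPDF_self_add (m v : EuclideanSpace ℝ (Fin D)) (σ : ℝ) :
    gaussPDF m σ (m + v) = gaussPDF 0 σ v := by
  simp [gaussPDF]

/-- A linear image of a centered Gaussian has mean zero. -/
lemma integral_gaussPDF_smul_linear_eq_zero (σ r : ℝ)
    (L : EuclideanSpace ℝ (Fin D) →L[ℝ] EuclideanSpace ℝ (Fin N)) :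
    ∫ ε : EuclideanSpace ℝ (Fin D), (gaussPDF 0 σ ε * r) • L ε = 0 := by
  have : IsAddTorsionFree (EuclideanSpace ℝ (Fin N)) := .of_isTorsionFree ℝ _
  have h := integral_neg_eq_self
    (fun ε : EuclideanSpace ℝ (Fin D) => (gaussPDF 0 σ ε * r) • L ε) volume
  simp only [gaussPDF_zero_neg, map_neg, smul_neg, integral_neg] at h
  exact self_eq_neg.mp h.symm

/-- Chain rule for the gradient along a differentiable map. -/
lemma HasGradientAt.comp_adjoint {E F : Type*} [NormedAddCommGroup E] [InnerProductSpace ℝ E]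
    [CompleteSpace E] [NormedAddCommGroup F] [InnerProductSpace ℝ F] [CompleteSpace F]
    {φ : F → ℝ} {φ' : F} {f : E → F} {L : E →L[ℝ] F} {x : E}
    (hφ : HasGradientAt φ φ' (f x)) (hf : HasFDerivAt f L x) :
    HasGradientAt (fun y => φ (f y)) (ContinuousLinearMap.adjoint L φ') x := by
  rw [hasGradientAt_iff_hasFDerivAt] at hφ ⊢
  refine (hφ.comp x hf).congr_fderiv ?_
  ext v
  simp [ContinuousLinearMap.adjoint_inner_left]

/-- The gradient of the reparameterized log-ratio: the Gaussian term is constant in `θ`, so only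
the score of `p` contributes. -/
lemma gradient_reparam_log_ratio {f : EuclideanSpace ℝ (Fin N) → EuclideanSpace ℝ (Fin D)}
    {p : EuclideanSpace ℝ (Fin D) → ℝ} {θ : EuclideanSpace ℝ (Fin N)}
    (hf : DifferentiableAt ℝ f θ) (hp : Differentiable ℝ p) (hp_pos : ∀ x, 0 < p x)
    {α : ℝ} (hα : α ≠ 0) (σ r : ℝ) (ε : EuclideanSpace ℝ (Fin D)) :
    gradient (fun θ' => r * σ / α * (log (gaussPDF (α • f θ') σ (α • f θ' + σ • ε)) -
        log (p (α • f θ' + σ • ε)))) θ =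
      -(r • ContinuousLinearMap.adjoint (fderiv ℝ f θ)
        (σ • gradient (fun x => log (p x)) (α • f θ + σ • ε))) := by
  simp only [gaussPDF_self_add]
  have hlog : HasGradientAt (fun x => log (p x))
      (gradient (fun x => log (p x)) (α • f θ + σ • ε)) (α • f θ + σ • ε) :=
    ((hp _).log (hp_pos _).ne').hasGradientAt
  have hinner : HasFDerivAt (fun θ' => α • f θ' + σ • ε) (α • fderiv ℝ f θ) θ :=
    (hf.hasFDerivAt.const_smul α).add_const _
  have hcomp := HasGradientAt.comp_adjoint (f := fun θ' => α • f θ' + σ • ε) hlog hinner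
  apply HasGradientAt.gradient
  rw [hasGradientAt_iff_hasFDerivAt] at hcomp ⊢
  refine ((hcomp.const_sub (log (gaussPDF 0 σ (σ • ε)))).const_mul (r * σ / α)).congr_fderiv ?_
  simp only [map_smulₛₗ, map_neg, smul_apply, smul_neg, smul_smul,
    RingHom.id_apply, conj_trivial]
  congr 2
  field_simp

/-- **SDS minimizes the KL objective.** The Score Distillation Sampling update equals the
gradient of the KL objective:
`−E_{t,c,ε}[ ω(t) (∂g(θ,c)/∂θ)ᵀ (σ_t ∇log p_t(x_t) − ε) ] = ∇_θ J_KL(θ)` with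
`x_t = α_t g(θ,c) + σ_t ε`; equivalently, the extra noise term satisfies
`E_{t,c,ε}[ ω(t) (∂g(θ,c)/∂θ)ᵀ ε ] = 0`.  The hypothesis `hDUI` encodes reparameterization
and differentiation under the integral sign, and the `Integrable` hypotheses encode the
blanket assumption that all the integrals involved are finite. -/
theorem sds_update_eq_gradient_Jkl
    (pc : Measure C) [IsProbabilityMeasure pc]
    (T : ℝ) (hT : 0 < T) (a s w : ℝ → ℝ)
    (ha : ∀ t ∈ Set.Icc (0 : ℝ) T, 0 < a t)
    (hs : ∀ t ∈ Set.Icc (0 : ℝ) T, 0 < s t)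
    (hw : ∀ t ∈ Set.Icc (0 : ℝ) T, 0 < w t)
    (g : EuclideanSpace ℝ (Fin N) → C → EuclideanSpace ℝ (Fin D))
    (hg : ∀ c : C, Differentiable ℝ (fun θ' => g θ' c))
    (p : ℝ → EuclideanSpace ℝ (Fin D) → ℝ)
    (hp_pos : ∀ t x, 0 < p t x)
    (hp_smooth : ∀ t, ContDiff ℝ (⊤ : ℕ∞) (p t))
    (θ : EuclideanSpace ℝ (Fin N))
    (hDUI : gradient (Jkl pc T a s w g p) θ =
      (1 / T) • ∫ t in Set.Icc (0 : ℝ) T, (∫ c, (∫ ε : EuclideanSpace ℝ (Fin D),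
        gaussPDF 0 1 ε •
          gradient (fun θ' => w t * s t / a t *
            (log (gaussPDF (a t • g θ' c) (s t) (a t • g θ' c + s t • ε)) -
              log (p t (a t • g θ' c + s t • ε)))) θ) ∂pc))
    (hInt_score : ∀ t ∈ Set.Icc (0 : ℝ) T, ∀ c : C,
      Integrable (fun ε : EuclideanSpace ℝ (Fin D) =>
        (gaussPDF 0 1 ε * w t) •
          ContinuousLinearMap.adjoint (fderiv ℝ (fun θ' => g θ' c) θ)
            (s t • gradient (fun x => log (p t x)) (a t • g θ c + s t • ε))))
    (hInt_noise : ∀ t ∈ Set.Icc (0 : ℝ) T, ∀ c : C,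
      Integrable (fun ε : EuclideanSpace ℝ (Fin D) =>
        (gaussPDF 0 1 ε * w t) •
          ContinuousLinearMap.adjoint (fderiv ℝ (fun θ' => g θ' c) θ) ε)) :
    (-((1 / T) • ∫ t in Set.Icc (0 : ℝ) T, (∫ c, (∫ ε : EuclideanSpace ℝ (Fin D),
        (gaussPDF 0 1 ε * w t) •
          ContinuousLinearMap.adjoint (fderiv ℝ (fun θ' => g θ' c) θ)
            (s t • gradient (fun x => log (p t x)) (a t • g θ c + s t • ε) - ε)) ∂pc)) =
      gradient (Jkl pc T a s w g p) θ) ∧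
    ((1 / T) • ∫ t in Set.Icc (0 : ℝ) T, (∫ c, (∫ ε : EuclideanSpace ℝ (Fin D),
        (gaussPDF 0 1 ε * w t) •
          ContinuousLinearMap.adjoint (fderiv ℝ (fun θ' => g θ' c) θ) ε) ∂pc)
      = (0 : EuclideanSpace ℝ (Fin N))) := by
  have noise (t : ℝ) (c : C) := integral_gaussPDF_smul_linear_eq_zero 1 (w t)
    (ContinuousLinearMap.adjoint (fderiv ℝ (fun θ' => g θ' c) θ))
  refine ⟨?_, by simp only [noise, integral_zero, smul_zero]⟩
  rw [hDUI, ← smul_neg, ← integral_neg]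
  congr 1
  refine setIntegral_congr_fun measurableSet_Icc fun t ht => ?_
  simp only [← integral_neg (μ := pc)]
  refine integral_congr_ae (.of_forall fun c => ?_)
  simp only [map_sub, smul_sub]
  rw [integral_sub (hInt_score t ht c) (hInt_noise t ht c), noise, sub_zero, ← integral_neg]
  refine integral_congr_ae (.of_forall fun ε => ?_)
  have hgrad := gradient_reparam_log_ratio (hg c θ) ((hp_smooth t).differentiable (by simp))
    (hp_pos t) (ha t ht).ne' (s t) (w t) ε
  simp only [hgrad, smul_neg, smul_smul]

end
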